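/- For p > 0, ∫₀¹ t^p |2/3 − t|^p dt = (2/3)^{1+2p} B(1+p, 1+p) + (1/3)^{1+p}/(p+1) · ₂F₁(−p, 1; p+2; 1/3), where B is the Beta function and ₂F₁(a,b;c;z) = (1/B(b,c−b)) ∫₀¹ s^{b−1}(1−s)^{c−b−1}(1−zs)^{−a} ds. -/

import Mathlib

theorem stmt_18 (p : ℝ) (hp : 0 < p) :
    ∫ t in (0:ℝ)..1, t ^ p * |2 / 3 - t| ^ p =
      (2 / 3 : ℝ) ^ (1 + 2 * p) *
          (∫ s in (0:ℝ)..1, s ^ ((1 + p) - 1) * (1 - s) ^ ((1 + p) - 1))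
        + (1 / 3 : ℝ) ^ (1 + p) / (p + 1) *
          ((1 / ∫ s in (0:ℝ)..1, s ^ ((1:ℝ) - 1) * (1 - s) ^ ((p + 2) - 1 - 1)) *
            ∫ s in (0:ℝ)..1, s ^ ((1:ℝ) - 1) * (1 - s) ^ ((p + 2) - 1 - 1) * (1 - s / 3) ^ p) := by
  have e1 : (1 + p) - 1 = p := by ring
  have e2 : (p + 2) - 1 - 1 = p := by ring
  simp only [e1, e2, sub_self, Real.rpow_zero, one_mul]
  have hB : ∫ s in (0:ℝ)..1, (1 - s) ^ p = 1 / (p + 1) := by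
    rw [intervalIntegral.integral_comp_sub_left (fun x : ℝ => x ^ p) 1]
    rw [sub_self, sub_zero, integral_rpow (Or.inl (by linarith))]
    rw [Real.one_rpow, Real.zero_rpow (by linarith), sub_zero]
  have hc : Continuous (fun t : ℝ => t ^ p * |2 / 3 - t| ^ p) :=
    (Real.continuous_rpow_const hp.le).mul
      ((Real.continuous_rpow_const hp.le).comp (by fun_prop : Continuous fun t : ℝ => |2 / 3 - t|))
  have h1 : ∫ t in (0:ℝ)..(2/3), t ^ p * |2 / 3 - t| ^ p =
      (2 / 3 : ℝ) ^ (1 + 2 * p) * ∫ s in (0:ℝ)..1, s ^ p * (1 - s) ^ p := by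
    have h := intervalIntegral.mul_integral_comp_mul_left (a := 0) (b := 1)
      (f := fun t : ℝ => t ^ p * |2 / 3 - t| ^ p) (2/3 : ℝ)
    rw [mul_zero, mul_one] at h
    rw [← h, ← intervalIntegral.integral_const_mul, ← intervalIntegral.integral_const_mul]
    apply intervalIntegral.integral_congr
    intro s hs
    rw [Set.uIcc_of_le zero_le_one] at hs
    have h1s : 0 ≤ 1 - s := by linarith [hs.2]
    have : |2 / 3 - 2 / 3 * s| = 2 / 3 * (1 - s) := by
      rw [abs_of_nonneg (by linarith)]; ring
    simp only [this]
    rw [Real.mul_rpow (by norm_num) hs.1, Real.mul_rpow (by norm_num) h1s,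
      show 1 + 2 * p = 1 + p + p by ring, Real.rpow_add (by norm_num),
      Real.rpow_add (by norm_num), Real.rpow_one]
    ring
  have h2 : ∫ t in (2/3:ℝ)..1, t ^ p * |2 / 3 - t| ^ p =
      (1 / 3 : ℝ) ^ (1 + p) * ∫ s in (0:ℝ)..1, (1 - s) ^ p * (1 - s / 3) ^ p := by
    have h := intervalIntegral.mul_integral_comp_sub_mul (a := 0) (b := 1)
      (f := fun t : ℝ => t ^ p * |2 / 3 - t| ^ p) (1/3 : ℝ) 1
    rw [mul_zero, mul_one, sub_zero, show (1:ℝ) - 1/3 = 2/3 by norm_num] at h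
    rw [← h, ← intervalIntegral.integral_const_mul, ← intervalIntegral.integral_const_mul]
    apply intervalIntegral.integral_congr
    intro s hs
    rw [Set.uIcc_of_le zero_le_one] at hs
    have h1s : 0 ≤ 1 - s := by linarith [hs.2]
    have : |2 / 3 - (1 - 1 / 3 * s)| = 1 / 3 * (1 - s) := by
      rw [abs_of_nonpos (by linarith)]; ring
    simp only [this]
    rw [Real.mul_rpow (by norm_num) h1s, Real.rpow_add (by norm_num), Real.rpow_one,
      show 1 - 1 / 3 * s = 1 - s / 3 by ring]
    ring
  rw [← intervalIntegral.integral_add_adjacent_intervals (hc.intervalIntegrable 0 (2/3))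
    (hc.intervalIntegrable (2/3) 1), h1, h2, hB]
  have : p + 1 ≠ 0 := by linarith
  field_simp
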